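/- arXiv:2307.06311 — 2 statements merged into one kernel-verified Lean document; each statement's English description precedes it below -/
import Mathlib

section
/- Fix an integer n ≥ 1. Let U be the real symmetric matrix defined as follows. Its index set is I₁ ⊔ I₂ ⊔ I₃, where I₁ = {(T,ℓ) : T a 3-element subset of {1,…,n}, ℓ ∈ T}, I₂ = {(i,j) : i,j ∈ {1,…,n}, i ≠ j}, and I₃ = {1,…,n} × {1,…,n} with elements written (î,ĵ). Using Iverson brackets [P] ∈ {0,1}, the entries of U are: for (T,ℓ), (T′,ℓ′) ∈ I₁: 6(|T ∩ T′| + [ℓ = ℓ′]); for (i,j), (i′,j′) ∈ I₂: 6[j = j′] + 30[i = i′] + 12[i = j′] + 12[j = i′]; for (î,ĵ), (î′,ĵ′) ∈ I₃: 3(|{î,ĵ} ∩ {î′,ĵ′}| + [î = î′]) if î ≠ ĵ and î′ ≠ ĵ′, and 3(3[î = î′] + 2[ĵ = ĵ′]) if î = ĵ or î′ = ĵ′; for (T,ℓ) ∈ I₁ and (i′,j′) ∈ I₂: 12[i′ ∈ T] + 6[j′ ∈ T] + 6[i′ = ℓ]; for (T,ℓ) ∈ I₁ and (î,ĵ) ∈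 I₃: 6[î ∈ T] + 3[ĵ ∈ T] + 3[ĵ = ℓ]; for (i,j) ∈ I₂ and (î,ĵ) ∈ I₃: 15 if i = î and j = ĵ; otherwise 21 if i = î and i = ĵ; otherwise 12 if i = î and j ≠ î and i ≠ ĵ; otherwise 15 if j = î and i = ĵ; otherwise 9 if i = ĵ and j ≠ î and i ≠ î; otherwise 9 if î = ĵ and j = î; otherwise 6 if j = î and i ≠ ĵ and j ≠ ĵ; otherwise 3 if j = ĵ and î ≠ ĵ; otherwise 0; and the entries with row index in a later block than the column index are given by symmetry. Then U is positive semidefinite. -/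
open Matrix

/-- Iverson bracket. -/
noncomputable def iv (P : Prop) [Decidable P] : ℝ := if P then 1 else 0

/-- Index block 1: pairs (T, ℓ) with T a 3-element subset and ℓ ∈ T. -/
abbrev I1 (n : ℕ) := {p : Finset (Fin n) × Fin n // p.1.card = 3 ∧ p.2 ∈ p.1}
/-- Index block 2: pairs (i, j) with i ≠ j. -/
abbrev I2 (n : ℕ) := {p : Fin n × Fin n // p.1 ≠ p.2}
/-- Index block 3: all pairs (î, ĵ). -/
abbrev I3 (n : ℕ) := Fin n × Fin n
/-- Full index set of the matrix U. -/
abbrev Idx (n : ℕ) := I1 n ⊕ I2 n ⊕ I3 n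

noncomputable def u11 {n : ℕ} (T : Finset (Fin n)) (l : Fin n) (T' : Finset (Fin n)) (l' : Fin n) : ℝ :=
  6 * (((T ∩ T').card : ℝ) + iv (l = l'))

noncomputable def u22 {n : ℕ} (i j i' j' : Fin n) : ℝ :=
  6 * iv (j = j') + 30 * iv (i = i') + 12 * iv (i = j') + 12 * iv (j = i')

noncomputable def u33 {n : ℕ} (i j i' j' : Fin n) : ℝ :=
  if i ≠ j ∧ i' ≠ j' then
    3 * (((({i, j} : Finset (Fin n)) ∩ ({i', j'} : Finset (Fin n))).card : ℝ) + iv (i = i'))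
  else
    3 * (3 * iv (i = i') + 2 * iv (j = j'))

noncomputable def u12 {n : ℕ} (T : Finset (Fin n)) (l : Fin n) (i' j' : Fin n) : ℝ :=
  12 * iv (i' ∈ T) + 6 * iv (j' ∈ T) + 6 * iv (i' = l)

noncomputable def u13 {n : ℕ} (T : Finset (Fin n)) (l : Fin n) (i' j' : Fin n) : ℝ :=
  6 * iv (i' ∈ T) + 3 * iv (j' ∈ T) + 3 * iv (j' = l)

noncomputable def u23 {n : ℕ} (i j i' j' : Fin n) : ℝ :=
  if i = i' ∧ j = j' then 15
  else if i = i' ∧ i = j' then 21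
  else if i = i' ∧ j ≠ i' ∧ i ≠ j' then 12
  else if j = i' ∧ i = j' then 15
  else if i = j' ∧ j ≠ i' ∧ i ≠ i' then 9
  else if i' = j' ∧ j = i' then 9
  else if j = i' ∧ i ≠ j' ∧ j ≠ j' then 6
  else if j = j' ∧ i' ≠ j' then 3
  else 0

/-- The Gram matrix U of the paper. -/
noncomputable def matU (n : ℕ) : Matrix (Idx n) (Idx n) ℝ :=
  Matrix.of fun x y =>
    match x, y with
    | .inl a, .inl b => u11 a.1.1 a.1.2 b.1.1 b.1.2
    | .inl a, .inr (.inl b) => u12 a.1.1 a.1.2 b.1.1 b.1.2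
    | .inl a, .inr (.inr b) => u13 a.1.1 a.1.2 b.1 b.2
    | .inr (.inl a), .inl b => u12 b.1.1 b.1.2 a.1.1 a.1.2
    | .inr (.inl a), .inr (.inl b) => u22 a.1.1 a.1.2 b.1.1 b.1.2
    | .inr (.inl a), .inr (.inr b) => u23 a.1.1 a.1.2 b.1 b.2
    | .inr (.inr a), .inl b => u13 b.1.1 b.1.2 a.1 a.2
    | .inr (.inr a), .inr (.inl b) => u23 b.1.1 b.1.2 a.1 a.2
    | .inr (.inr a), .inr (.inr b) => u33 a.1 a.2 b.1 b.2


noncomputable def fA (n : ℕ) : Matrix (Fin n) (Idx n) ℝ :=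
  Matrix.of fun k x =>
    match x with
    | .inl a => iv (k ∈ a.1.1)
    | .inr (.inl a) => 2 * iv (k = a.1.1) + iv (k = a.1.2)
    | .inr (.inr a) => iv (k = a.1) + (1/2) * iv (k = a.2)

noncomputable def fB (n : ℕ) : Matrix (Fin n) (Idx n) ℝ :=
  Matrix.of fun k x =>
    match x with
    | .inl a => iv (k = a.1.2)
    | .inr (.inl a) => iv (k = a.1.1)
    | .inr (.inr a) => (1/2) * iv (k = a.2)

theorem sum_eq_eq {n : ℕ} (i j : Fin n) : ∑ k, iv (k = i) * iv (k = j) = iv (i = j) := by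
  simp [iv, eq_comm]

theorem sum_eq_mem {n : ℕ} (i : Fin n) (T : Finset (Fin n)) :
    ∑ k, iv (k = i) * iv (k ∈ T) = iv (i ∈ T) := by
  simp [iv]

theorem sum_mem_mem {n : ℕ} (S T : Finset (Fin n)) :
    ∑ k, iv (k ∈ S) * iv (k ∈ T) = ((S ∩ T).card : ℝ) := by
  simp only [iv, mul_ite, mul_one, mul_zero, ← ite_and]
  rw [Finset.sum_boole]
  congr 2
  ext k
  simp [and_comm]

theorem iv_comm {n : ℕ} (i j : Fin n) : iv (i = j) = iv (j = i) := by
  simp [iv, eq_comm]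

theorem bil {n : ℕ} (a b c d : ℝ) (i j i' j' : Fin n) :
    ∑ k, (a * iv (k = i) + b * iv (k = j)) * (c * iv (k = i') + d * iv (k = j'))
      = a * c * iv (i = i') + a * d * iv (i = j') + b * c * iv (j = i') + b * d * iv (j = j') := by
  rw [← sum_eq_eq i i', ← sum_eq_eq i j', ← sum_eq_eq j i', ← sum_eq_eq j j']
  simp only [Finset.mul_sum, ← Finset.sum_add_distrib]
  exact Finset.sum_congr rfl fun k _ => by ring

theorem bilT {n : ℕ} (a b : ℝ) (i j : Fin n) (T : Finset (Fin n)) :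
    ∑ k, (a * iv (k = i) + b * iv (k = j)) * iv (k ∈ T)
      = a * iv (i ∈ T) + b * iv (j ∈ T) := by
  rw [← sum_eq_mem i, ← sum_eq_mem j]
  simp only [Finset.mul_sum, ← Finset.sum_add_distrib]
  exact Finset.sum_congr rfl fun k _ => by ring

theorem u33_eq {n : ℕ} (i j i' j' : Fin n) :
    u33 i j i' j' = 6 * iv (i = i') + 3 * iv (i = j') + 3 * iv (j = i') + 3 * iv (j = j') := by
  unfold u33
  split_ifs with h
  · obtain ⟨h1, h2⟩ := h
    rw [← sum_mem_mem]
    have e : ∀ a b : Fin n, a ≠ b → ∀ k, iv (k ∈ ({a, b} : Finset (Fin n)))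
        = 1 * iv (k = a) + 1 * iv (k = b) := by
      intro a b hab k
      by_cases h3 : k = a
      · subst h3; simp [iv, hab]
      · simp [iv, h3]
    simp only [e i j h1, e i' j' h2]
    rw [bil]; ring
  · unfold iv
    by_cases h1 : i = j
    · subst h1
      by_cases h2 : i = i' <;> by_cases h3 : i = j' <;> simp only [if_pos, if_neg, h2, h3] <;> grind
    · have h2 : i' = j' := by tauto
      subst h2
      by_cases h2 : i = i' <;> by_cases h3 : j = i' <;> simp only [if_pos, if_neg, h2, h3] <;> grind

theorem u23_eq {n : ℕ} (i j i' j' : Fin n) (h : i ≠ j) :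
    u23 i j i' j' = 12 * iv (i = i') + 9 * iv (i = j') + 6 * iv (j = i') + 3 * iv (j = j') := by
  unfold u23 iv
  by_cases h1 : i = i' <;> by_cases h2 : i = j' <;> by_cases h3 : j = i' <;>
    by_cases h4 : j = j' <;> simp only [h1, h2, h3, h4] <;> grind

theorem matU_eq (n : ℕ) : matU n = (6 : ℝ) • ((fA n)ᴴ * fA n + (fB n)ᴴ * fB n) := by
  have key : ∀ x y, ((fA n)ᴴ * fA n + (fB n)ᴴ * fB n) x y
      = ∑ k, fA n k x * fA n k y + ∑ k, fB n k x * fB n k y := by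
    intro x y
    simp [Matrix.mul_apply]
  have s : ∀ x y, (6:ℝ) * (∑ k, fA n k x * fA n k y + ∑ k, fB n k x * fB n k y)
     = 6 * (∑ k, fA n k y * fA n k x + ∑ k, fB n k y * fB n k x) := by
    intro x y; simp only [mul_comm]
  have c12 : ∀ (a : I1 n) (b : I2 n), u12 a.1.1 a.1.2 b.1.1 b.1.2 =
      6 * (∑ k, fA n k (.inr (.inl b)) * fA n k (.inl a)
        + ∑ k, fB n k (.inr (.inl b)) * fB n k (.inl a)) := by
    intro a b
    have := bilT 2 1 b.1.1 b.1.2 a.1.1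
    simp only [one_mul] at this
    simp only [fA, fB, Matrix.of_apply, this, sum_eq_eq, u12]
    ring
  have c13 : ∀ (a : I1 n) (b : I3 n), u13 a.1.1 a.1.2 b.1 b.2 =
      6 * (∑ k, fA n k (.inr (.inr b)) * fA n k (.inl a)
        + ∑ k, fB n k (.inr (.inr b)) * fB n k (.inl a)) := by
    intro a b
    have := bilT 1 (1/2) b.1 b.2 a.1.1
    simp only [one_mul] at this
    simp only [fA, fB, Matrix.of_apply, this, mul_assoc, ← Finset.mul_sum, sum_eq_eq, u13]
    ring
  have c23 : ∀ (a : I2 n) (b : I3 n), u23 a.1.1 a.1.2 b.1 b.2 =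
      6 * (∑ k, fA n k (.inr (.inl a)) * fA n k (.inr (.inr b))
        + ∑ k, fB n k (.inr (.inl a)) * fB n k (.inr (.inr b))) := by
    intro a b
    have h1 := bil 2 1 1 (1/2) a.1.1 a.1.2 b.1 b.2
    have h2 := bil 1 0 0 (1/2) a.1.1 a.1.2 b.1 b.2
    simp only [one_mul, zero_mul, add_zero, zero_add, mul_zero] at h1 h2
    simp only [fA, fB, Matrix.of_apply, h1, h2, u23_eq _ _ _ _ a.2]
    ring
  ext x y
  rw [Matrix.smul_apply, key, smul_eq_mul]
  rcases x with a | a | a <;> rcases y with b | b | b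
  · simp only [matU, fA, fB, Matrix.of_apply, sum_mem_mem, sum_eq_eq, u11]
  · rw [s]; exact c12 a b
  · rw [s]; exact c13 a b
  · exact c12 b a
  · have h1 := bil 2 1 2 1 a.1.1 a.1.2 b.1.1 b.1.2
    simp only [one_mul] at h1
    simp only [matU, fA, fB, Matrix.of_apply, h1, sum_eq_eq, u22]
    ring
  · exact c23 a b
  · exact c13 b a
  · rw [s]; exact c23 b a
  · have h1 := bil 1 (1/2) 1 (1/2) a.1 a.2 b.1 b.2
    have h2 := bil 0 (1/2) 0 (1/2) a.1 a.2 b.1 b.2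
    simp only [one_mul, zero_mul, add_zero, zero_add, mul_zero] at h1 h2
    simp only [matU, fA, fB, Matrix.of_apply, h1, h2, u33_eq]
    ring

/-- U is positive semidefinite. -/
theorem matU_posSemidef (n : ℕ) (hn : 1 ≤ n) : (matU n).PosSemidef := by
  rw [matU_eq]
  exact ((Matrix.posSemidef_conjTranspose_mul_self (fA n)).add
    (Matrix.posSemidef_conjTranspose_mul_self (fB n))).smul (by norm_num)
end

section
/- Fix an integer n ≥ 2. Let U be the real symmetric matrix defined as follows. Its index set is I₁ ⊔ I₂ ⊔ I₃, where I₁ = {(T,ℓ) : T a 3-element subset of {1,…,n}, ℓ ∈ T}, I₂ = {(i,j) : i,j ∈ {1,…,n}, i ≠ j}, and I₃ = {1,…,n} × {1,…,n} with elements written (î,ĵ). Using Iverson brackets [P] ∈ {0,1}, the entries of U are: for (T,ℓ), (T′,ℓ′) ∈ I₁: 6(|T ∩ T′| + [ℓ = ℓ′]); for (i,j), (i′,j′) ∈ I₂: 6[j = j′] + 30[i = i′] + 12[i = j′] + 12[j = i′]; for (î,ĵ), (î′,ĵ′) ∈ I₃: 3(|{î,ĵ} ∩ {î′,ĵ′}|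 + [î = î′]) if î ≠ ĵ and î′ ≠ ĵ′, and 3(3[î = î′] + 2[ĵ = ĵ′]) if î = ĵ or î′ = ĵ′; for (T,ℓ) ∈ I₁ and (i′,j′) ∈ I₂: 12[i′ ∈ T] + 6[j′ ∈ T] + 6[i′ = ℓ]; for (T,ℓ) ∈ I₁ and (î,ĵ) ∈ I₃: 6[î ∈ T] + 3[ĵ ∈ T] + 3[ĵ = ℓ]; for (i,j) ∈ I₂ and (î,ĵ) ∈ I₃: 15 if i = î and j = ĵ; otherwise 21 if i = î and i = ĵ; otherwise 12 if i = î and j ≠ î and i ≠ ĵ; otherwise 15 if j = î and i = ĵ; otherwise 9 if i = ĵ and j ≠ î and i ≠ î; otherwise 9 if î = ĵ and j = î; otherwise 6 if j = î and i ≠ ĵ and j ≠ ĵ; otherwise 3 if j = ĵ and î ≠ ĵ; otherwise 0; and the entries with row index in a later block than the column index are given by symmetry. Let e_α denote the standard basis vector at index α. Then for all i, j ∈ {1,…,n}, the vector e_{(î,ĵ)} − e_{(î,n̂)} − e_{(n̂,ĵ)} + e_{(n̂,n̂)} (with all four indices in I₃) lies in the kernel of U: U·(e_{(î,ĵ)}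 − e_{(î,n̂)} − e_{(n̂,ĵ)} + e_{(n̂,n̂)}) = 0. -/
open Matrix

theorem u23_add {n : ℕ} (i j i' j' : Fin n) (h : i ≠ j) :
    u23 i j i' j' = (12 * iv (i = i') + 6 * iv (j = i')) + (9 * iv (i = j') + 3 * iv (j = j')) := by
  unfold u23 iv
  by_cases h1 : i = i' <;> by_cases h2 : j = i' <;> by_cases h3 : i = j' <;>
    by_cases h4 : j = j' <;> by_cases h5 : i' = j' <;> first
    | (exfalso; grind)
    | (simp only [h1, h2, h3, h4, h5, if_true, if_false]; grind)

theorem card_pair_inter {n : ℕ} (i j i' j' : Fin n) (h : i ≠ j) (h' : i' ≠ j') :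
    ((({i, j} : Finset (Fin n)) ∩ ({i', j'} : Finset (Fin n))).card : ℝ)
      = iv (i = i') + iv (j = i') + iv (i = j') + iv (j = j') := by
  rw [← Finset.filter_mem_eq_inter, Finset.card_filter, Finset.sum_pair h]
  unfold iv
  simp only [Finset.mem_insert, Finset.mem_singleton]
  push_cast
  grind

theorem u33_add {n : ℕ} (i j i' j' : Fin n) (h : i ≠ j) :
    u33 i j i' j' = (6 * iv (i = i') + 3 * iv (j = i')) + (3 * iv (i = j') + 3 * iv (j = j')) := by
  unfold u33
  by_cases h' : i' = j'
  · subst h'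
    simp only [ne_eq, not_true_eq_false, and_false, if_false]
    ring
  · rw [if_pos ⟨h, h'⟩, card_pair_inter i j i' j' h h']
    ring

theorem u33_diag {n : ℕ} (i i' j' : Fin n) :
    u33 i i i' j' = 9 * iv (i = i') + 6 * iv (i = j') := by
  unfold u33
  simp only [ne_eq, not_true_eq_false, false_and, if_false]
  ring

/-- the vectors e_{(î,ĵ)} − e_{(î,n̂)} − e_{(n̂,ĵ)} + e_{(n̂,n̂)}
(indices in block 3, with n̂ the last index) lie in the kernel of U. -/
theorem matU_kernel_block3 (n : ℕ) (hn : 2 ≤ n) (i j : Fin n) :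
    matU n *ᵥ
      (Pi.single (Sum.inr (Sum.inr (i, j)) : Idx n) (1 : ℝ)
        - Pi.single (Sum.inr (Sum.inr (i, (⟨n - 1, by omega⟩ : Fin n))) : Idx n) 1
        - Pi.single (Sum.inr (Sum.inr ((⟨n - 1, by omega⟩ : Fin n), j)) : Idx n) 1
        + Pi.single (Sum.inr (Sum.inr ((⟨n - 1, by omega⟩ : Fin n), (⟨n - 1, by omega⟩ : Fin n))) : Idx n) 1)
    = 0 := by
  rw [Matrix.mulVec_add, Matrix.mulVec_sub, Matrix.mulVec_sub]
  simp only [Matrix.mulVec_single_one]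
  generalize (⟨n - 1, by omega⟩ : Fin n) = m
  funext x
  rcases x with ⟨⟨T, l⟩, hT⟩ | ⟨⟨a, b⟩, hab⟩ | ⟨a, b⟩
  · simp only [Pi.add_apply, Pi.sub_apply, Matrix.col_apply, matU, Matrix.of_apply, Pi.zero_apply, u13]
    ring
  · simp only [Pi.add_apply, Pi.sub_apply, Matrix.col_apply, matU, Matrix.of_apply, Pi.zero_apply]
    simp only [u23_add _ _ _ _ hab]
    ring
  · simp only [Pi.add_apply, Pi.sub_apply, Matrix.col_apply, matU, Matrix.of_apply, Pi.zero_apply]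
    by_cases hab : a = b
    · subst hab
      simp only [u33_diag]
      ring
    · simp only [u33_add _ _ _ _ hab]
      ring
end
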